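/- Let X be a set and consider the simplicial complex (or semi-simplicial set) of injective words on X: p-simplices are injective tuples (x₀,…,x_p) of elements of X, with face maps deleting entries. If X is infinite, the geometric realization of the complex of injective words on X is contractible. -/

import Mathlib

/-- Injective words of length `p+1` on a set `X`. -/
def InjWord (X : Type*) (p : ℕ) : Type _ := {f : Fin (p + 1) → X // Function.Injective f}

/-- Injective words carry the discrete topology (the set `X` has no topology). -/
instance {X : Type*} {p : ℕ} : TopologicalSpace (InjWord X p) := ⊥

/-- The standard topological `p`-simplex. -/
def SimplexStd (p : ℕ) : Type :=
  {w : Fin (p + 1) → ℝ // (∀ i, 0 ≤ w i) ∧ ∑ i, w i = 1}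

instance {p : ℕ} : TopologicalSpace (SimplexStd p) :=
  inferInstanceAs (TopologicalSpace {w : Fin (p + 1) → ℝ // _})

/-- The gluing relation of the (thick) geometric realization of the semi-simplicial
set of injective words: `(f, δ_i w) ∼ (d_i f, w)`, where `d_i` deletes the `i`-th
letter and `δ_i` is the corresponding coface of standard simplices. -/
inductive InjWordsRel (X : Type*) :
    (Σ p : ℕ, InjWord X p × SimplexStd p) → (Σ p : ℕ, InjWord X p × SimplexStd p) → Prop
  | face {p : ℕ} (i : Fin (p + 2)) (f : InjWord X (p + 1)) (w : SimplexStd p)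
      (w' : SimplexStd (p + 1)) (hw : w'.val = i.insertNth 0 w.val) :
      InjWordsRel X ⟨p + 1, f, w'⟩
        ⟨p, ⟨f.val ∘ i.succAbove, f.prop.comp (Fin.succAbove_right_injective)⟩, w⟩

/-- The geometric realization of the complex of injective words on `X`. -/
def InjWordsRealization (X : Type*) : Type _ := Quot (InjWordsRel X)

instance {X : Type*} : TopologicalSpace (InjWordsRealization X) :=
  inferInstanceAs (TopologicalSpace (Quot _))

namespace InjWordsProof

open scoped NNReal

/-- A choice of fresh letters. -/
theorem exists_fresh (X : Type*) [Infinite X] : ∃ a : Finset X → X,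
    (∀ F, a F ∉ F) ∧ ∀ F G, F ⊂ G → a F ≠ a G := by
  classical
  have key : ∀ (s : Finset X) (ih : ∀ t : Finset X, t ⊂ s → X),
      ∃ x : X, x ∉ s ∧ ∀ t (h : t ⊂ s), ih t h ≠ x := by
    intro s ih
    obtain ⟨x, hx⟩ := Infinite.exists_notMem_finset
      (s ∪ s.ssubsets.attach.image (fun G : {t // t ∈ s.ssubsets} => ih G.1 (Finset.mem_ssubsets.1 G.2)))
    rw [Finset.mem_union, not_or] at hx
    refine ⟨x, hx.1, fun t h he => hx.2 (Finset.mem_image.2 ?_)⟩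
    exact ⟨⟨t, Finset.mem_ssubsets.2 h⟩, Finset.mem_attach _ _, he⟩
  choose step h1 h2 using key
  obtain ⟨a, ha⟩ : ∃ a : Finset X → X, ∀ s, a s = step s (fun t _ => a t) :=
    ⟨Finset.strongInduction step, Finset.strongInduction_eq step⟩
  refine ⟨a, fun F => ?_, fun F G h => ?_⟩
  · rw [ha]; exact h1 _ _
  · rw [ha G]; exact h2 G (fun t _ => a t) F h

section Points

variable {X : Type*}

/-- normalised weights -/
noncomputable def nrm {p : ℕ} (v : Fin (p + 1) → ℝ≥0) (h : ∑ i, v i ≠ 0) : SimplexStd p :=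
  ⟨fun i => ((v i / ∑ j, v j : ℝ≥0) : ℝ), fun _ => NNReal.coe_nonneg _, by
    rw [← NNReal.coe_sum, ← Finset.sum_div, div_self h, NNReal.coe_one]⟩

open Classical in
/-- the point of the realization with letters `f` and weights proportional to `u` -/
noncomputable def ptF (d : InjWordsRealization X) : (n : ℕ) → (Fin n → X) → (X → ℝ≥0) →
    InjWordsRealization X
  | 0, _, _ => d
  | p + 1, f, u => if h : Function.Injective f ∧ ∑ i, u (f i) ≠ 0 then
      Quot.mk _ ⟨p, ⟨f, h.1⟩, nrm (fun i => u (f i)) h.2⟩ else d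

theorem ptF_pos (d : InjWordsRealization X) {p : ℕ} (f : Fin (p + 1) → X) (u : X → ℝ≥0)
    (hf : Function.Injective f) (h : ∑ i, u (f i) ≠ 0) :
    ptF d (p + 1) f u = Quot.mk _ ⟨p, ⟨f, hf⟩, nrm (fun i => u (f i)) h⟩ := by
  unfold ptF
  exact dif_pos ⟨hf, h⟩

theorem ptF_neg (d : InjWordsRealization X) {n : ℕ} (f : Fin n → X) (u : X → ℝ≥0)
    (h : ∑ i, u (f i) = 0) : ptF d n f u = d := by
  cases n with
  | zero => rfl
  | succ n =>
    unfold ptF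
    exact dif_neg (fun hh => hh.2 h)

theorem ptF_erase (d : InjWordsRealization X) {n : ℕ} (f : Fin (n + 1) → X) (u : X → ℝ≥0)
    (i : Fin (n + 1)) (hf : Function.Injective f) (hu : u (f i) = 0) :
    ptF d (n + 1) f u = ptF d n (f ∘ i.succAbove) u := by
  have hs : ∑ j, u (f j) = ∑ j, u ((f ∘ i.succAbove) j) := by
    rw [Fin.sum_univ_succAbove _ i, hu, zero_add]; rfl
  by_cases h : ∑ j, u (f j) = 0
  · rw [ptF_neg d f u h, ptF_neg d _ u (hs ▸ h)]
  · cases n with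
    | zero => exact absurd hs (by simpa using h)
    | succ n =>
      rw [ptF_pos d f u hf h, ptF_pos d (f ∘ i.succAbove) u
        (hf.comp Fin.succAbove_right_injective) (hs ▸ h)]
      apply Quot.sound
      apply InjWordsRel.face i ⟨f, hf⟩
      funext j
      refine Fin.succAboveCases i ?_ (fun j => ?_) j
      · simp [nrm, hu]
      · simp only [nrm, Fin.insertNth_apply_succAbove]
        rw [hs]
        rfl

/-- list version -/
noncomputable def P (d : InjWordsRealization X) (L : List X) (u : X → ℝ≥0) :
    InjWordsRealization X := ptF d L.length L.get u

theorem ptF_congr (d : InjWordsRealization X) {n m : ℕ} (h : n = m) (f : Fin n → X)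
    (g : Fin m → X) (u : X → ℝ≥0) (hfg : ∀ i, f i = g (Fin.cast h i)) :
    ptF d n f u = ptF d m g u := by
  subst h
  congr 1
  funext i
  exact hfg i

theorem P_ofFn (d : InjWordsRealization X) {n : ℕ} (f : Fin n → X) (u : X → ℝ≥0) :
    P d (List.ofFn f) u = ptF d n f u := by
  apply ptF_congr d (List.length_ofFn)
  intro i
  simp
  rfl

theorem ofFn_succAbove {n : ℕ} (f : Fin (n + 1) → X) (i : Fin (n + 1)) :
    List.ofFn (f ∘ i.succAbove) = (List.ofFn f).eraseIdx i := by
  apply List.ext_getElem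
  · rw [List.length_eraseIdx]; simp [i.2]
  · intro j h1 h2
    rw [List.getElem_eraseIdx]
    simp only [List.getElem_ofFn, Function.comp]
    split_ifs with h
    · congr 1; apply Fin.ext; rw [Fin.succAbove_of_castSucc_lt]; rfl; exact h
    · congr 1; apply Fin.ext; rw [Fin.succAbove_of_le_castSucc]; rfl; exact not_lt.1 h

theorem P_erase (d : InjWordsRealization X) (L : List X) (hL : L.Nodup) (u : X → ℝ≥0)
    (i : ℕ) (hi : i < L.length) (hu : u L[i] = 0) : P d L u = P d (L.eraseIdx i) u := by
  obtain ⟨n, f, rfl⟩ : ∃ n, ∃ f : Fin n → X, L = List.ofFn f := ⟨_, L.get, by simp⟩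
  cases n with
  | zero => simp at hi
  | succ n =>
    have hi' : i < n + 1 := by simpa using hi
    have := ofFn_succAbove f ⟨i, hi'⟩
    rw [← this, P_ofFn, P_ofFn]
    apply ptF_erase d f u _ (List.nodup_ofFn.1 hL)
    rw [List.getElem_ofFn] at hu
    exact hu

theorem P_filter (d : InjWordsRealization X) (u : X → ℝ≥0) (L : List X) (hL : L.Nodup) :
    P d L u = P d (L.filter (fun x => u x ≠ 0)) u := by
  induction hn : L.length generalizing L with
  | zero => rw [List.length_eq_zero_iff.1 hn]; rfl
  | succ n ih =>
    by_cases h : ∀ x ∈ L, u x ≠ 0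
    · rw [List.filter_eq_self.2 (by simpa using h)]
    · push Not at h
      obtain ⟨x, hx, hux⟩ := h
      obtain ⟨i, hi, rfl⟩ := List.getElem_of_mem hx
      rw [P_erase d L hL u i hi hux, ih _ (hL.sublist (List.eraseIdx_sublist ..))
        (by rw [List.length_eraseIdx]; rw [if_pos hi]; omega)]
      congr 1
      rw [List.eraseIdx_eq_take_drop_succ]
      conv_rhs => rw [← List.take_append_drop i L, List.drop_eq_getElem_cons hi]
      rw [List.filter_append, List.filter_append, List.filter_cons_of_neg (by simpa using hux)]

theorem continuous_P (d : InjWordsRealization X) {Z : Type*} [TopologicalSpace Z]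
    (L : List X) (hL : L.Nodup) (u : Z → X → ℝ≥0) (hu : ∀ x, Continuous fun z => u z x)
    (hne : ∀ z, ∃ x ∈ L, u z x ≠ 0) : Continuous fun z => P d L (u z) := by
  obtain ⟨n, f, rfl⟩ : ∃ n, ∃ f : Fin n → X, L = List.ofFn f := ⟨_, L.get, by simp⟩
  simp only [P_ofFn]
  cases n with
  | zero => exact continuous_const
  | succ n =>
    have hs : ∀ z, ∑ i, u z (f i) ≠ 0 := by
      intro z h0
      obtain ⟨x, hx, hux⟩ := hne z
      obtain ⟨i, rfl⟩ := (List.mem_ofFn' _ _).1 hx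
      rw [Finset.sum_eq_zero_iff] at h0
      exact hux (h0 i (Finset.mem_univ _))
    have : (fun z => ptF d (n + 1) f (u z)) = fun z => Quot.mk (InjWordsRel X)
        ⟨n, ⟨f, List.nodup_ofFn.1 hL⟩, nrm (fun i => u z (f i)) (hs z)⟩ :=
      funext fun z => ptF_pos d f (u z) (List.nodup_ofFn.1 hL) (hs z)
    rw [this]
    refine continuous_quot_mk.comp (continuous_sigmaMk.comp (Continuous.prodMk continuous_const ?_))
    refine Continuous.subtype_mk (continuous_pi fun i => ?_) _
    refine NNReal.continuous_coe.comp ?_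
    exact (hu _).div₀ (continuous_finsetSum _ fun j _ => hu _) hs

end Points

section Hom

variable {X : Type*} [LinearOrder X]

/-- length of the set of levels `s < t` with superlevel set `F` -/
noncomputable def mm (S F : Finset X) (w : X → ℝ≥0) (t : ℝ≥0) : ℝ≥0 :=
  F.fold min t w - (S \ F).sup w

theorem mm_ne {S F : Finset X} {w : X → ℝ≥0} {t : ℝ≥0} :
    mm S F w t ≠ 0 ↔ (S \ F).sup w < F.fold min t w := by
  rw [mm, ← pos_iff_ne_zero, tsub_pos_iff_lt]

/-- weight of the letter attached to `F` -/
noncomputable def cc (S F : Finset X) (w : X → ℝ≥0) (t : ℝ≥0) : ℝ≥0 :=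
  (if F = ∅ then 1 else 2 - t) * mm S F w t

theorem cc_mm {S F : Finset X} {w : X → ℝ≥0} {t : ℝ≥0} (h : cc S F w t ≠ 0) :
    mm S F w t ≠ 0 := right_ne_zero_of_mul h

theorem mm_lt_t {S F : Finset X} {w : X → ℝ≥0} {t : ℝ≥0} (h : mm S F w t ≠ 0) {x : X}
    (hx : x ∈ S) (hF : x ∉ F) : w x < t := by
  rw [mm_ne, Finset.lt_fold_min] at h
  exact (Finset.le_sup (Finset.mem_sdiff.2 ⟨hx, hF⟩)).trans_lt h.1

theorem mm_lt {S F : Finset X} {w : X → ℝ≥0} {t : ℝ≥0} (h : mm S F w t ≠ 0) {x y : X}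
    (hx : x ∈ S) (hF : x ∉ F) (hy : y ∈ F) : w x < w y := by
  rw [mm_ne, Finset.lt_fold_min] at h
  exact (Finset.le_sup (Finset.mem_sdiff.2 ⟨hx, hF⟩)).trans_lt (h.2 y hy)

theorem mm_supp {S F : Finset X} {w : X → ℝ≥0} {t : ℝ≥0} (h : mm S F w t ≠ 0) {y : X}
    (hy : y ∈ F) : w y ≠ 0 := by
  rw [mm_ne, Finset.lt_fold_min] at h
  exact (h.2 y hy).ne_bot

theorem mm_chain {S F G : Finset X} {w : X → ℝ≥0} {t : ℝ≥0} (hF : F ⊆ S) (hG : G ⊆ S)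
    (h : mm S F w t ≠ 0) (h' : mm S G w t ≠ 0) : F ⊆ G ∨ G ⊆ F := by
  by_contra! hh
  obtain ⟨x, hx, hx'⟩ := Finset.not_subset.1 hh.1
  obtain ⟨y, hy, hy'⟩ := Finset.not_subset.1 hh.2
  exact lt_asymm (mm_lt h (hG hy) hy' hx) (mm_lt h' (hF hx) hx' hy)

/-- unnormalised weights at time `t` -/
noncomputable def uu (a : Finset X → X) (S : Finset X) (w : X → ℝ≥0) (t : ℝ≥0) (x : X) : ℝ≥0 :=
  (w x - t) + ∑ F ∈ S.powerset, if a F = x then cc S F w t else 0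

/-- the word -/
def LL (a : Finset X → X) (l : List X) (G : Finset X) (C : Finset (Finset X)) : List X :=
  l.filter (fun x => x ∈ G) ++ (C.image a).sort

/-- admissible pairs -/
structure Good (S G : Finset X) (C : Finset (Finset X)) : Prop where
  CS : C ⊆ S.powerset
  GC : ∀ F ∈ C, G ⊆ F
  chain : ∀ F ∈ C, ∀ F' ∈ C, F ⊆ F' ∨ F' ⊆ F

/-- closed regions -/
structure Reg (S G : Finset X) (C : Finset (Finset X)) (w : X → ℝ≥0) (t : ℝ≥0) : Prop where
  le : ∀ x ∈ S, x ∉ G → w x ≤ t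
  zero : ∀ F ∈ S.powerset, F ∉ C → cc S F w t = 0

/-- canonical letters -/
noncomputable def Gc (S : Finset X) (w : X → ℝ≥0) (t : ℝ≥0) : Finset X := S.filter fun x => t < w x
/-- canonical chain -/
noncomputable def Cc (S : Finset X) (w : X → ℝ≥0) (t : ℝ≥0) : Finset (Finset X) :=
  S.powerset.filter fun F => cc S F w t ≠ 0

theorem good_c (S : Finset X) (w : X → ℝ≥0) (t : ℝ≥0) : Good S (Gc S w t) (Cc S w t) where
  CS := Finset.filter_subset _ _
  GC F hF x hx := by
    by_contra h
    rw [Gc, Finset.mem_filter] at hx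
    rw [Cc, Finset.mem_filter] at hF
    exact lt_asymm hx.2 (mm_lt_t (cc_mm hF.2) hx.1 h)
  chain F hF F' hF' := by
    rw [Cc, Finset.mem_filter, Finset.mem_powerset] at hF hF'
    exact mm_chain hF.1 hF'.1 (cc_mm hF.2) (cc_mm hF'.2)

theorem reg_c (S : Finset X) (w : X → ℝ≥0) (t : ℝ≥0) : Reg S (Gc S w t) (Cc S w t) w t where
  le x hx h := by
    rw [Gc, Finset.mem_filter] at h
    exact not_lt.1 fun h' => h ⟨hx, h'⟩
  zero F hF h := by
    rw [Cc, Finset.mem_filter] at h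
    by_contra h'
    exact h ⟨hF, h'⟩

variable {a : Finset X → X}
  {S G : Finset X} {C : Finset (Finset X)} {w : X → ℝ≥0} {t : ℝ≥0}

theorem LL_nodup (ha : ∀ F, a F ∉ F)
    {l : List X} (hl : l.Nodup) (hg : Good S G C) : (LL a l G C).Nodup := by
  rw [LL, List.nodup_append']
  refine ⟨hl.filter _, Finset.sort_nodup _ _, ?_⟩
  intro x hx hx'
  simp only [List.mem_filter, decide_eq_true_eq] at hx
  rw [Finset.mem_sort, Finset.mem_image] at hx'
  obtain ⟨F, hF, rfl⟩ := hx'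
  exact ha F (hg.GC F hF hx.2)

theorem a_inj (ha' : ∀ F G, F ⊂ G → a F ≠ a G)
    (hg : Good S G C) {F F' : Finset X} (hF : F ∈ C) (hF' : F' ∈ C)
    (h : a F = a F') : F = F' := by
  by_contra hne
  rcases hg.chain F hF F' hF' with h1 | h1
  · exact ha' F F' (h1.ssubset_of_ne hne) h
  · exact ha' F' F (h1.ssubset_of_ne (Ne.symm hne)) h.symm

theorem uu_G (ha : ∀ F, a F ∉ F)
    (hg : Good S G C) (hr : Reg S G C w t) {x : X} (hx : x ∈ G) :
    uu a S w t x = w x - t := by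
  rw [uu, Finset.sum_eq_zero, add_zero]
  intro F hF
  split_ifs with h
  · by_contra h0
    have hC : F ∈ C := by
      by_contra hC
      exact h0 (hr.zero F hF hC)
    exact ha F (h ▸ hg.GC F hC hx)
  · rfl

theorem uu_a (ha : ∀ F, a F ∉ F) (ha' : ∀ F G, F ⊂ G → a F ≠ a G)
    (hg : Good S G C) (hr : Reg S G C w t) (hw : ∀ x, x ∉ S → w x = 0)
    {F : Finset X} (hF : F ∈ C) :
    uu a S w t (a F) = cc S F w t := by
  have h1 : w (a F) - t = 0 := by
    rw [tsub_eq_zero_iff_le]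
    by_cases hS : a F ∈ S
    · exact hr.le _ hS fun h => ha F (hg.GC F hF h)
    · rw [hw _ hS]; exact zero_le
  rw [uu, h1, zero_add, Finset.sum_eq_single_of_mem F (hg.CS hF), if_pos rfl]
  intro F' hF' hne
  split_ifs with h
  · by_contra h0
    have hC : F' ∈ C := by
      by_contra hC
      exact h0 (hr.zero F' hF' hC)
    exact hne (a_inj ha' hg hC hF h)
  · rfl

theorem uu_supp {l : List X} (hl : ∀ x, x ∈ l ↔ x ∈ S) (hr : Reg S G C w t)
    (hw : ∀ x, x ∉ S → w x = 0)
    {x : X} (hx : uu a S w t x ≠ 0) : x ∈ LL a l G C := by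
  by_contra h
  simp only [LL, List.mem_append, List.mem_filter, decide_eq_true_eq, Finset.mem_sort,
    Finset.mem_image, hl, not_or, not_and, not_exists] at h
  apply hx
  rw [uu, Finset.sum_eq_zero, add_zero, tsub_eq_zero_iff_le]
  · by_cases hS : x ∈ S
    · exact hr.le _ hS (h.1 hS)
    · rw [hw _ hS]; exact zero_le
  · intro F hF
    split_ifs with h'
    · by_contra h0
      have hC : F ∈ C := by
        by_contra hC
        exact h0 (hr.zero F hF hC)
      exact h.2 F hC h'
    · rfl

theorem LL_filter (ha : ∀ F, a F ∉ F) (ha' : ∀ F G, F ⊂ G → a F ≠ a G)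
    {l : List X} (hl : ∀ x, x ∈ l ↔ x ∈ S) (hg : Good S G C) (hr : Reg S G C w t)
    (hw : ∀ x, x ∉ S → w x = 0) :
    (LL a l G C).filter (fun x => uu a S w t x ≠ 0) = LL a l (Gc S w t) (Cc S w t) := by
  rw [LL, LL, List.filter_append]
  congr 1
  · rw [List.filter_filter]
    apply List.filter_congr
    intro x hx
    rw [hl] at hx
    rw [← Bool.decide_and, decide_eq_decide]
    simp only [Gc, Finset.mem_filter, hx, true_and]
    constructor
    · rintro ⟨h1, h2⟩
      rw [uu_G ha hg hr h2] at h1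
      exact tsub_pos_iff_lt.1 (pos_iff_ne_zero.2 h1)
    · intro h
      have hG : x ∈ G := by
        by_contra hG
        exact absurd h (not_lt.2 (hr.le x hx hG))
      refine ⟨?_, hG⟩
      rw [uu_G ha hg hr hG]
      exact (tsub_pos_iff_lt.2 h).ne'
  · have e : ((C.image a).sort.filter (fun x => uu a S w t x ≠ 0)).toFinset
        = (Cc S w t).image a := by
      ext x
      simp only [List.mem_toFinset, List.mem_filter, Finset.mem_sort, Finset.mem_image, Cc,
        Finset.mem_filter, decide_eq_true_eq]
      constructor
      · rintro ⟨⟨F, hF, rfl⟩, h⟩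
        rw [uu_a ha ha' hg hr hw hF] at h
        exact ⟨F, ⟨hg.CS hF, h⟩, rfl⟩
      · rintro ⟨F, ⟨hF, h⟩, rfl⟩
        have hC : F ∈ C := by
          by_contra hC
          exact h (hr.zero F hF hC)
        refine ⟨⟨F, hC, rfl⟩, ?_⟩
        rwa [uu_a ha ha' hg hr hw hC]
    rw [← e]
    symm
    rw [List.toFinset_sort]
    · exact (Finset.pairwise_sort _ _).filter _
    · exact (Finset.sort_nodup _ _).filter _

theorem uu_ne (hw1 : ∀ x, w x ≤ 1) (hne : ∃ x, w x ≠ 0) (ht : t ≤ 2) :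
    ∃ x, uu a S w t x ≠ 0 := by
  rcases eq_or_ne t 0 with rfl | h0
  · obtain ⟨x, hx⟩ := hne
    exact ⟨x, by simp [uu, hx]⟩
  · set F := S.filter (fun x => t ≤ w x) with hF
    have hm : mm S F w t ≠ 0 := by
      rw [mm_ne, Finset.lt_fold_min, Finset.sup_lt_iff (pos_iff_ne_zero.2 h0)]
      have hh : ∀ b ∈ S \ F, w b < t := by
        intro b hb
        simp only [hF, Finset.mem_sdiff, Finset.mem_filter, not_and, not_le] at hb
        exact hb.2 hb.1
      refine ⟨hh, fun x hx => ?_⟩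
      rw [Finset.mem_filter] at hx
      exact ((Finset.sup_lt_iff (pos_iff_ne_zero.2 h0)).2 hh).trans_le hx.2
    have hc : cc S F w t ≠ 0 := by
      refine mul_ne_zero ?_ hm
      split_ifs with hE
      · exact one_ne_zero
      · obtain ⟨x, hx⟩ := Finset.nonempty_iff_ne_empty.2 hE
        rw [Finset.mem_filter] at hx
        refine (tsub_pos_iff_lt.2 ((hx.2.trans (hw1 x)).trans_lt ?_)).ne'
        norm_num
    refine ⟨a F, fun h => hc ?_⟩
    rw [uu, add_eq_zero] at h
    have := (Finset.sum_eq_zero_iff.1 h.2) F (Finset.mem_powerset.2 (Finset.filter_subset _ _))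
    simpa using this

/-- the homotopy -/
noncomputable def hom (d : InjWordsRealization X) (a : Finset X → X) (l : List X) (w : X → ℝ≥0)
    (t : ℝ≥0) : InjWordsRealization X :=
  P d (LL a l (Gc l.toFinset w t) (Cc l.toFinset w t)) (uu a l.toFinset w t)

theorem hom_eq (ha : ∀ F, a F ∉ F) (ha' : ∀ F G, F ⊂ G → a F ≠ a G)
    (d : InjWordsRealization X) {l : List X} (hl : l.Nodup)
    (hg : Good l.toFinset G C) (hr : Reg l.toFinset G C w t) (hw : ∀ x, x ∉ l → w x = 0) :
    hom d a l w t = P d (LL a l G C) (uu a l.toFinset w t) := by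
  rw [P_filter d _ _ (LL_nodup ha hl hg), LL_filter ha ha' (by simp) hg hr (by simpa using hw)]
  rfl

theorem continuous_cc {Z : Type*} [TopologicalSpace Z] (S F : Finset X) {w : Z → X → ℝ≥0}
    {t : Z → ℝ≥0} (hw : ∀ x, Continuous fun z => w z x) (ht : Continuous t) :
    Continuous fun z => cc S F (w z) (t z) := by
  unfold cc mm
  have h1 : Continuous fun z => F.fold min (t z) (w z) := by
    induction F using Finset.induction_on with
    | empty => simpa using ht
    | insert x F hx ih =>
      simp only [Finset.fold_insert hx]
      exact (hw x).min ih
  have h2 : Continuous fun z => (S \ F).sup (w z) := by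
    induction (S \ F) using Finset.induction_on with
    | empty => simpa using continuous_const
    | insert x F hx ih =>
      simp only [Finset.sup_insert]
      exact (hw x).sup ih
  refine Continuous.mul ?_ (h1.sub h2)
  split_ifs
  · exact continuous_const
  · exact continuous_const.sub ht

theorem continuous_uu {Z : Type*} [TopologicalSpace Z] (S : Finset X) {w : Z → X → ℝ≥0}
    {t : Z → ℝ≥0} (hw : ∀ x, Continuous fun z => w z x) (ht : Continuous t) (x : X) :
    Continuous fun z => uu a S (w z) (t z) x := by
  unfold uu
  refine ((hw x).sub ht).add (continuous_finsetSum _ fun F _ => ?_)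
  split_ifs
  · exact continuous_cc S F hw ht
  · exact continuous_const

theorem continuous_hom (ha : ∀ F, a F ∉ F) (ha' : ∀ F G, F ⊂ G → a F ≠ a G)
    (d : InjWordsRealization X) {Z : Type*} [TopologicalSpace Z] {l : List X}
    (hl : l.Nodup) {w : Z → X → ℝ≥0}
    {t : Z → ℝ≥0} (hw : ∀ x, Continuous fun z => w z x) (ht : Continuous t)
    (hw0 : ∀ z x, x ∉ l → w z x = 0) (hw1 : ∀ z x, w z x ≤ 1) (hne : ∀ z, ∃ x, w z x ≠ 0)
    (ht2 : ∀ z, t z ≤ 2) : Continuous fun z => hom d a l (w z) (t z) := by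
  set S := l.toFinset with hS
  let ι := {q : Finset X × Finset (Finset X) // q ∈ S.powerset ×ˢ S.powerset.powerset ∧
    Good S q.1 q.2}
  have : Finite ι := Finite.of_injective
    (fun q : ι => (⟨q.1, q.2.1⟩ : {q // q ∈ S.powerset ×ˢ S.powerset.powerset}))
    (fun q q' h => Subtype.ext (congrArg (fun z => z.1) h))
  let R : ι → Set Z := fun q => {z | Reg S q.1.1 q.1.2 (w z) (t z)}
  refine (locallyFinite_of_finite R).continuous (f := R) ?_ ?_ ?_
  · rw [Set.eq_univ_iff_forall]
    intro z
    rw [Set.mem_iUnion]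
    refine ⟨⟨(Gc S (w z) (t z), Cc S (w z) (t z)), ?_, good_c _ _ _⟩, reg_c _ _ _⟩
    rw [Finset.mem_product, Finset.mem_powerset, Finset.mem_powerset]
    exact ⟨Finset.filter_subset _ _, Finset.filter_subset _ _⟩
  · intro q
    have : R q = (⋂ x ∈ S, ⋂ (_ : x ∉ q.1.1), {z | w z x ≤ t z}) ∩
        ⋂ F ∈ S.powerset, ⋂ (_ : F ∉ q.1.2), {z | cc S F (w z) (t z) = 0} := by
      ext z
      simp only [Set.mem_inter_iff, Set.mem_iInter, Set.mem_ofPred_eq]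
      exact ⟨fun h => ⟨h.1, h.2⟩, fun h => ⟨h.1, h.2⟩⟩
    rw [this]
    refine IsClosed.inter ?_ ?_
    · exact isClosed_biInter fun x _ => isClosed_iInter fun _ => isClosed_le (hw x) ht
    · exact isClosed_biInter fun F _ => isClosed_iInter fun _ =>
        isClosed_eq (continuous_cc S F hw ht) continuous_const
  · intro q
    rw [continuousOn_iff_continuous_domRestrict]
    have e : (R q).domRestrict (fun z => hom d a l (w z) (t z)) =
        fun z : R q => P d (LL a l q.1.1 q.1.2) (uu a S (w z) (t z)) :=
      funext fun z => hom_eq ha ha' d hl q.2.2 z.2 (hw0 z)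
    rw [e]
    refine continuous_P d _ (LL_nodup ha hl q.2.2) _ (fun x => ?_) (fun z => ?_)
    · exact (continuous_uu S hw ht x).comp continuous_subtype_val
    · obtain ⟨x, hx⟩ := uu_ne (a := a) (S := S) (hw1 z) (hne z) (ht2 z)
      exact ⟨x, uu_supp (by simp [hS]) z.2 (by simpa [hS] using hw0 z) hx, hx⟩

/-- dropping letters of weight zero -/
theorem mm_mono {S' : Finset X} (hS : S' ⊆ S) (hw : ∀ x, x ∉ S' → w x = 0) (F : Finset X) :
    mm S' F w t = mm S F w t := by
  unfold mm
  congr 1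
  apply le_antisymm
  · exact Finset.sup_mono (Finset.sdiff_subset_sdiff hS le_rfl)
  · apply Finset.sup_le
    intro x hx
    by_cases h : x ∈ S'
    · exact Finset.le_sup (Finset.mem_sdiff.2 ⟨h, (Finset.mem_sdiff.1 hx).2⟩)
    · rw [hw x h]; exact zero_le

theorem cc_mono {S' : Finset X} (hS : S' ⊆ S) (hw : ∀ x, x ∉ S' → w x = 0) (F : Finset X) :
    cc S' F w t = cc S F w t := by
  unfold cc; rw [mm_mono hS hw]

theorem cc_sub {S' : Finset X} (hw : ∀ x, x ∉ S' → w x = 0) {F : Finset X}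
    (h : cc S F w t ≠ 0) : F ⊆ S' := by
  intro y hy
  by_contra hy'
  exact mm_supp (cc_mm h) hy (hw y hy')

theorem uu_mono {S' : Finset X} (hS : S' ⊆ S) (hw : ∀ x, x ∉ S' → w x = 0) :
    uu a S' w t = uu a S w t := by
  funext x
  unfold uu
  congr 1
  rw [← Finset.sum_subset (Finset.powerset_mono.2 hS)]
  · exact Finset.sum_congr rfl fun F _ => by rw [cc_mono hS hw]
  · intro F _ hF
    split_ifs
    · by_contra h
      exact hF (Finset.mem_powerset.2 (cc_sub hw h))
    · rfl

theorem hom_mono (d : InjWordsRealization X) {l l' : List X} (hl : l.Nodup) (hs : l'.Sublist l)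
    (hw : ∀ x, x ∉ l' → w x = 0) : hom d a l w t = hom d a l' w t := by
  have hS : l'.toFinset ⊆ l.toFinset := by
    intro x; simpa using fun h => hs.subset h
  have hw' : ∀ x, x ∉ l'.toFinset → w x = 0 := by simpa using hw
  unfold hom
  rw [uu_mono hS hw']
  congr 1
  unfold LL
  congr 1
  · symm
    have h1 : l.filter (fun x => x ∈ Gc l.toFinset w t) = l.filter (fun x => t < w x) :=
      List.filter_congr fun x hx => by simp [Gc, hx]
    have h2 : l'.filter (fun x => x ∈ Gc l'.toFinset w t) = l'.filter (fun x => t < w x) :=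
      List.filter_congr fun x hx => by simp [Gc, hx]
    rw [h1, h2]
    apply (hs.filter _).eq_of_length_le
    apply List.Subperm.length_le
    apply List.subperm_of_subset (hl.filter _)
    intro x hx
    simp only [List.mem_filter, decide_eq_true_eq] at hx ⊢
    refine ⟨?_, hx.2⟩
    by_contra h
    rw [hw x h] at hx
    exact not_lt_zero hx.2
  · congr 2
    ext F
    simp only [Cc, Finset.mem_filter, Finset.mem_powerset, cc_mono hS hw']
    exact ⟨fun h => ⟨cc_sub hw' h.2, h.2⟩, fun h => ⟨h.1.trans hS, h.2⟩⟩

theorem fold_zero (F : Finset X) : F.fold min 0 w = 0 :=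
  le_antisymm ((Finset.fold_min_le _).2 (Or.inl le_rfl)) zero_le

theorem hom_zero (ha : ∀ F, a F ∉ F) (ha' : ∀ F G, F ⊂ G → a F ≠ a G)
    (d : InjWordsRealization X) {l : List X} (hl : l.Nodup)
    (hw : ∀ x, x ∉ l → w x = 0) : hom d a l w 0 = P d l w := by
  have hc : ∀ F, cc l.toFinset F w 0 = 0 := by
    intro F; simp [cc, mm, fold_zero]
  have hg : Good l.toFinset l.toFinset ∅ := ⟨by simp, by simp, by simp⟩
  have hr : Reg l.toFinset l.toFinset ∅ w 0 := ⟨fun x h h' => absurd h h', by simp [hc]⟩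
  rw [hom_eq ha ha' d hl hg hr hw]
  have h1 : LL a l l.toFinset ∅ = l := by
    simp [LL]
  have h2 : uu a l.toFinset w 0 = w := by
    funext x; simp [uu, hc]
  rw [h1, h2]

theorem hom_two (ha : ∀ F, a F ∉ F) (ha' : ∀ F G, F ⊂ G → a F ≠ a G)
    (d : InjWordsRealization X) {l : List X} (hl : l.Nodup)
    (hw : ∀ x, x ∉ l → w x = 0) (hw1 : ∀ x, w x ≤ 1) (hne : ∃ x, w x ≠ 0) :
    hom d a l w 2 = P d [a ∅] (fun _ => 1) := by
  have hg : Good l.toFinset ∅ {∅} := ⟨by simp, by simp, by simp⟩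
  have hr : Reg l.toFinset ∅ {∅} w 2 := by
    refine ⟨fun x _ _ => (hw1 x).trans (by norm_num), fun F _ hF => ?_⟩
    rw [Finset.mem_singleton] at hF
    simp [cc, hF]
  rw [hom_eq ha ha' d hl hg hr hw]
  have h1 : LL a l ∅ {∅} = List.ofFn (fun _ : Fin 1 => a ∅) := by simp [LL]
  have h1' : [a ∅] = List.ofFn (fun _ : Fin 1 => a ∅) := by simp
  obtain ⟨x, hx⟩ := uu_ne (a := a) (S := l.toFinset) hw1 hne le_rfl
  have hx' := uu_supp (l := l) (a := a) (by simp) hr (by simpa using hw) hx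
  rw [h1, ← h1', List.mem_singleton] at hx'
  subst hx'
  rw [h1', h1, P_ofFn, P_ofFn, ptF_pos d _ _ (fun i j _ => Fin.ext (by omega)) (by simpa using hx),
    ptF_pos d _ _ (fun i j _ => Fin.ext (by omega)) (by simp)]
  congr 3
  apply Subtype.ext
  funext i
  have : uu a l.toFinset w 2 (a ∅) ≠ 0 := hx
  simp [nrm, this]

end Hom

section Final

variable {X : Type*} [LinearOrder X]

/-- weights on letters -/
noncomputable def wt {p : ℕ} (f : Fin (p + 1) → X) (s : SimplexStd p) (x : X) : ℝ≥0 :=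
  ∑ i, if f i = x then (s.1 i).toNNReal else 0

theorem wt_apply {p : ℕ} (f : Fin (p + 1) → X) (hf : Function.Injective f) (s : SimplexStd p)
    (i : Fin (p + 1)) : wt f s (f i) = (s.1 i).toNNReal := by
  simp [wt, hf.eq_iff]

theorem wt_sum {p : ℕ} (s : SimplexStd p) : ∑ i, (s.1 i).toNNReal = 1 := by
  rw [← Real.toNNReal_sum_of_nonneg (fun i _ => s.2.1 i), s.2.2, Real.toNNReal_one]

theorem wt_zero {p : ℕ} (f : Fin (p + 1) → X) (s : SimplexStd p) (x : X)
    (hx : x ∉ List.ofFn f) : wt f s x = 0 := by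
  apply Finset.sum_eq_zero
  intro i _
  rw [if_neg]
  rintro rfl
  exact hx ((List.mem_ofFn' _ _).2 ⟨i, rfl⟩)

theorem wt_le {p : ℕ} (f : Fin (p + 1) → X) (s : SimplexStd p) (x : X) : wt f s x ≤ 1 := by
  rw [← wt_sum s]
  apply Finset.sum_le_sum
  intro i _
  split_ifs
  · exact le_rfl
  · exact zero_le

theorem wt_ne {p : ℕ} (f : Fin (p + 1) → X) (hf : Function.Injective f) (s : SimplexStd p) :
    ∃ x, wt f s x ≠ 0 := by
  by_contra! h
  have := wt_sum s
  rw [Finset.sum_eq_zero] at this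
  · exact zero_ne_one this
  · intro i _
    rw [← wt_apply f hf, h]

theorem wt_cont {p : ℕ} (f : Fin (p + 1) → X) (x : X) :
    Continuous fun s : SimplexStd p => wt f s x := by
  unfold wt
  refine continuous_finsetSum _ fun i _ => ?_
  split_ifs
  · exact continuous_real_toNNReal.comp ((continuous_apply i).comp continuous_subtype_val)
  · exact continuous_const

theorem wt_face {p : ℕ} (i : Fin (p + 2)) (f : Fin (p + 2) → X) (s : SimplexStd p)
    (s' : SimplexStd (p + 1)) (h : s'.val = i.insertNth 0 s.val) :
    wt f s' = wt (f ∘ i.succAbove) s := by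
  funext x
  unfold wt
  rw [Fin.sum_univ_succAbove _ i, h]
  simp

theorem P_wt (d : InjWordsRealization X) {p : ℕ} (f : InjWord X p) (s : SimplexStd p) :
    P d (List.ofFn f.1) (wt f.1 s) = Quot.mk _ ⟨p, f, s⟩ := by
  have hs : ∑ i, wt f.1 s (f.1 i) = 1 := by
    rw [← wt_sum s]
    exact Finset.sum_congr rfl fun i _ => wt_apply f.1 f.2 s i
  rw [P_ofFn, ptF_pos d f.1 _ f.2 (by rw [hs]; exact one_ne_zero)]
  congr 3
  apply Subtype.ext
  funext i
  simp only [nrm]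
  rw [hs, div_one, wt_apply f.1 f.2, Real.coe_toNNReal _ (s.2.1 i)]

theorem main [Infinite X] : ContractibleSpace (InjWordsRealization X) := by
  obtain ⟨a, ha, ha'⟩ := exists_fresh X
  have hone : (∀ i : Fin 1, (0 : ℝ) ≤ (fun _ => 1 : Fin 1 → ℝ) i) ∧
      ∑ i : Fin 1, (fun _ => 1 : Fin 1 → ℝ) i = 1 := by simp
  let d : InjWordsRealization X := Quot.mk _ ⟨0, ⟨fun _ => a ∅,
    fun i j _ => Fin.ext (by omega)⟩, ⟨fun _ => 1, hone⟩⟩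
  clear_value d
  let τ : unitInterval → ℝ≥0 := fun t => 2 * t.1.toNNReal
  have hτ : Continuous τ :=
    continuous_const.mul (continuous_real_toNNReal.comp continuous_subtype_val)
  have hτ2 : ∀ t, τ t ≤ 2 := by
    intro t
    have : t.1.toNNReal ≤ 1 := Real.toNNReal_le_one.2 t.2.2
    calc τ t ≤ 2 * 1 := mul_le_mul_right this 2
      _ = 2 := mul_one 2
  have hc : ∀ p (f : InjWord X p), Continuous fun z : SimplexStd p × unitInterval =>
      hom d a (List.ofFn f.1) (wt f.1 z.1) (τ z.2) := by
    intro p f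
    exact continuous_hom ha ha' d (List.nodup_ofFn.2 f.2)
      (fun x => (wt_cont f.1 x).comp continuous_fst) (hτ.comp continuous_snd)
      (fun z x hx => wt_zero _ _ _ hx) (fun z x => wt_le _ _ _) (fun z => wt_ne _ f.2 _)
      (fun z => hτ2 _)
  let K : (Σ p : ℕ, InjWord X p × SimplexStd p) → C(unitInterval, InjWordsRealization X) :=
    fun q => (ContinuousMap.mk _ (hc q.1 q.2.1)).curry q.2.2
  have hK : Continuous K := by
    rw [continuous_sigma_iff]
    intro p
    have : DiscreteTopology (InjWord X p) := ⟨rfl⟩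
    rw [continuous_prod_of_discrete_left]
    intro f
    exact (ContinuousMap.mk _ (hc p f)).curry.continuous
  have hrel : ∀ q q', InjWordsRel X q q' → K q = K q' := by
    rintro _ _ ⟨i, f, s, s', h⟩
    apply ContinuousMap.ext
    intro t
    change hom d a (List.ofFn f.1) (wt f.1 s') (τ t) =
      hom d a (List.ofFn (f.1 ∘ i.succAbove)) (wt (f.1 ∘ i.succAbove) s) (τ t)
    rw [wt_face i f.1 s s' h]
    apply hom_mono d (List.nodup_ofFn.2 f.2)
    · rw [ofFn_succAbove]; exact List.eraseIdx_sublist ..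
    · exact fun x hx => wt_zero _ _ _ hx
  let KK : C(InjWordsRealization X, C(unitInterval, InjWordsRealization X)) :=
    ⟨Quot.lift K hrel, continuous_quot_lift _ hK⟩
  rw [contractible_iff_id_nullhomotopic]
  refine ⟨P d [a ∅] (fun _ => 1), ⟨⟨⟨fun z => KK z.2 z.1, ?_⟩, ?_, ?_⟩⟩⟩
  · exact (ContinuousMap.continuous_uncurry_of_continuous KK).comp continuous_swap
  · rintro ⟨p, f, s⟩
    change hom d a (List.ofFn f.1) (wt f.1 s) (2 * (0 : ℝ).toNNReal) = Quot.mk _ ⟨p, f, s⟩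
    rw [Real.toNNReal_zero, mul_zero, hom_zero ha ha' d (List.nodup_ofFn.2 f.2)
      (fun x hx => wt_zero _ _ _ hx), P_wt]
  · rintro ⟨p, f, s⟩
    change hom d a (List.ofFn f.1) (wt f.1 s) (2 * (1 : ℝ).toNNReal) = _
    rw [Real.toNNReal_one, mul_one, hom_two ha ha' d (List.nodup_ofFn.2 f.2)
      (fun x hx => wt_zero _ _ _ hx) (wt_le _ _) (wt_ne _ f.2 _)]
    rfl

end Final

end InjWordsProof

/-- If `X` is infinite, the geometric realization of the complex of
injective words on `X` is contractible. -/
theorem stmt12 (X : Type*) [Infinite X] : ContractibleSpace (InjWordsRealization X) := by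
  classical
  let : LinearOrder X := linearOrderOfSTO (WellOrderingRel (α := X))
  exact InjWordsProof.main
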